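/- arXiv:2201.02157 — 2 statements merged into one kernel-verified Lean document; each statement's English description precedes it below -/
import Mathlib

section
/- Let Σ̂ be a two-sided countable Markov shift, ψ a Markov potential, P ≥ 0, and a ≠ b ∈ ℕ symbols, and let μ be a σ-invariant Borel probability measure on Σ̂ satisfying μ([a]) > 0, μ([b]) > 0, μ({x : x_i = a for infinitely many i ≥ 0}) = 1, μ({x : x_i = b for infinitely many i ≥ 0}) = 1, and μ([x_0 … x_n]) = μ([x_0])·exp(ψ(γ) − n·P) for every loop γ = x_0 … x_n with x_n = x_0. Suppose there exist N ∈ ℕ, B ≥ 0 and a loop δ at a passing through b with l(δ) ≤ N and ψ(δ) ≥ −B. Then 1 − p_{aa} ≥ exp(−B − N·P). -/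
open MeasureTheory Filter Topology BoundedContinuousFunction
open scoped ENNReal NNReal

noncomputable section

/-! ## Countable Markov shifts (one-sided) -/

/-- The one-sided countable Markov shift over the alphabet `ℕ` determined by the
transition matrix (relation) `A`. -/
structure MShift (A : ℕ → ℕ → Prop) : Type where
  seq : ℕ → ℕ
  adm : ∀ i : ℕ, A (seq i) (seq (i + 1))

/-- The topology generated by the cylinders: the topology induced from the product
topology on `ℕ → ℕ` (with `ℕ` discrete). -/
instance (A : ℕ → ℕ → Prop) : TopologicalSpace (MShift A) :=
  TopologicalSpace.induced MShift.seq inferInstance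

/-- The Borel σ-algebra on the shift space. -/
instance (A : ℕ → ℕ → Prop) : MeasurableSpace (MShift A) := borel (MShift A)

instance (A : ℕ → ℕ → Prop) : BorelSpace (MShift A) := ⟨rfl⟩

/-- The shift map `σ`. -/
def shiftMap (A : ℕ → ℕ → Prop) (x : MShift A) : MShift A :=
  ⟨fun i => x.seq (i + 1), fun i => x.adm (i + 1)⟩

/-- No row and no column of the transition matrix is identically zero. -/
def NoZeroRC (A : ℕ → ℕ → Prop) : Prop :=
  ∀ i : ℕ, (∃ j, A i j) ∧ (∃ j, A j i)

/-- The cylinder `[x₀ … x_{n-1}]` determined by a finite word `w`. -/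
def cylSet (A : ℕ → ℕ → Prop) (w : List ℕ) : Set (MShift A) :=
  {x | ∀ i < w.length, x.seq i = w.getD i 0}

/-- A path: an admissible word `x₀ … xₙ` with `n ≥ 1` and nonempty cylinder. -/
def IsPath (A : ℕ → ℕ → Prop) (w : List ℕ) : Prop :=
  2 ≤ w.length ∧ w.Chain' A ∧ (cylSet A w).Nonempty

/-- The length `l(γ) = n` of a path `γ = x₀ … xₙ` (represented as a list of `n+1` symbols). -/
def pathLen (w : List ℕ) : ℕ := w.length - 1

/-- The weight `φ(γ) = Σ_{k=0}^{n-1} ψ(x_k x_{k+1})` of a word under a Markov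
potential determined by `ψ : ℕ → ℕ → ℝ`. -/
def pathWt (ψ : ℕ → ℕ → ℝ) : List ℕ → ℝ
  | [] => 0
  | [_] => 0
  | a :: b :: l => ψ a b + pathWt ψ (b :: l)

/-- Topological transitivity: any two symbols are connected by a path. -/
def TopTrans (A : ℕ → ℕ → Prop) : Prop :=
  ∀ a b : ℕ, ∃ w : List ℕ, IsPath A w ∧ w.headI = a ∧ w.getLastD 0 = b

/-- The Birkhoff sum `Sₙφ`. -/
def birkhoff (A : ℕ → ℕ → Prop) (φ : MShift A → ℝ) (n : ℕ) (x : MShift A) : ℝ :=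
  ∑ i ∈ Finset.range n, φ ((shiftMap A)^[i] x)

/-- The Gurevich partition function `Zₙ(φ, a)`. -/
def Zpart (A : ℕ → ℕ → Prop) (φ : MShift A → ℝ) (n : ℕ) (a : ℕ) : ℝ≥0∞ :=
  ∑' x : {x : MShift A // (shiftMap A)^[n] x = x ∧ x.seq 0 = a},
    ENNReal.ofReal (Real.exp (birkhoff A φ n x.1))

/-- `Zₙ*(φ, a)`: the partition function restricted to first returns to `a`. -/
def ZpartStar (A : ℕ → ℕ → Prop) (φ : MShift A → ℝ) (n : ℕ) (a : ℕ) : ℝ≥0∞ :=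
  ∑' x : {x : MShift A // (shiftMap A)^[n] x = x ∧ x.seq 0 = a ∧
      ∀ k, 0 < k → k < n → x.seq k ≠ a},
    ENNReal.ofReal (Real.exp (birkhoff A φ n x.1))

/-- The Gurevich pressure `P_G(φ) = limsup (1/n) log Zₙ(φ, a)` (at the symbol `a`),
as an extended real number. -/
def PGur (A : ℕ → ℕ → Prop) (φ : MShift A → ℝ) (a : ℕ) : EReal :=
  Filter.atTop.limsup fun n : ℕ => (((n : ℝ)⁻¹ : ℝ) : EReal) * ENNReal.log (Zpart A φ n a)

/-- `p` is the (common, symbol-independent) value of the Gurevich pressure of `φ`. -/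
def IsPG (A : ℕ → ℕ → Prop) (φ : MShift A → ℝ) (p : EReal) : Prop :=
  ∀ a : ℕ, (∃ x : MShift A, x.seq 0 = a) → PGur A φ a = p

/-- `φ` is a summable potential: `Σᵢ exp (sup φ|_[i]) < ∞`. -/
def SummablePot (A : ℕ → ℕ → Prop) (φ : MShift A → ℝ) : Prop :=
  ∃ s : ℕ → ℝ, Summable (fun i => Real.exp (s i)) ∧
    ∀ (i : ℕ) (x : MShift A), x.seq 0 = i → φ x ≤ s i

/-- `V` is a bound for the `n`-th variation `Varₙ(φ)`. -/
def VarBdd (A : ℕ → ℕ → Prop) (φ : MShift A → ℝ) (n : ℕ) (V : ℝ) : Prop :=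
  ∀ x y : MShift A, (∀ i < n, x.seq i = y.seq i) → |φ x - φ y| ≤ V

/-- σ-invariance of a Borel measure on the shift space. -/
def ShiftInv (A : ℕ → ℕ → Prop) (μ : Measure (MShift A)) : Prop :=
  ∀ s : Set (MShift A), MeasurableSet s → μ (shiftMap A ⁻¹' s) = μ s

/-- The maximal ergodic average `α(φ)`. -/
def alphaSup (A : ℕ → ℕ → Prop) (φ : MShift A → ℝ) : ℝ :=
  sSup {r : ℝ | ∃ μ : Measure (MShift A), IsProbabilityMeasure μ ∧ ShiftInv A μ ∧
    Integrable φ μ ∧ r = ∫ x, φ x ∂μ}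

/-- `μ` is the Gurevich–Markov (stationary Markov equilibrium) measure associated to the
Markov potential `ψ` with pressure `p`. -/
structure IsGM (A : ℕ → ℕ → Prop) (ψ : ℕ → ℕ → ℝ) (p : ℝ) (μ : Measure (MShift A)) : Prop where
  prob : IsProbabilityMeasure μ
  inv : ShiftInv A μ
  eigen : ∃ h hT : ℕ → ℝ, (∀ a, 0 < h a) ∧ (∀ a, 0 < hT a) ∧
    (∀ j : ℕ, (∑' a : {a : ℕ // A a j}, ENNReal.ofReal (Real.exp (ψ a.1 j) * h a.1))
        = ENNReal.ofReal (Real.exp p * h j)) ∧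
    (∀ j : ℕ, (∑' b : {b : ℕ // A j b}, ENNReal.ofReal (Real.exp (ψ j b.1) * hT b.1))
        = ENNReal.ofReal (Real.exp p * hT j)) ∧
    (∑' a : ℕ, ENNReal.ofReal (h a * hT a)) = 1 ∧
    (∀ w : List ℕ, w ≠ [] → w.Chain' A → (cylSet A w).Nonempty →
      μ (cylSet A w) = ENNReal.ofReal
        (h w.headI * hT (w.getLastD 0) * Real.exp (pathWt ψ w - (pathLen w : ℝ) * p)))

/-! ## Loops and main paths (one-sided) -/

/-- A loop at `a`. -/
def IsLoopAt (A : ℕ → ℕ → Prop) (a : ℕ) (w : List ℕ) : Prop :=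
  IsPath A w ∧ w.headI = a ∧ w.getLastD 0 = a

/-- The word `w` passes through `b`, i.e. some intermediate symbol of `w` equals `b`. -/
def PassesThrough (w : List ℕ) (b : ℕ) : Prop :=
  ∃ m, 0 < m ∧ m < w.length - 1 ∧ w.getD m 0 = b

/-- No intermediate symbol of `w` lies in `J`. -/
def AvoidsIn (w : List ℕ) (J : Finset ℕ) : Prop :=
  ∀ m, 0 < m → m < w.length - 1 → w.getD m 0 ∉ J

/-- A first-return loop at `c`: a loop at `c` with no intermediate occurrence of `c`. -/
def FirstRetLoop (A : ℕ → ℕ → Prop) (c : ℕ) (w : List ℕ) : Prop :=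
  IsPath A w ∧ w.headI = c ∧ w.getLastD 0 = c ∧
    ∀ m, 0 < m → m < w.length - 1 → w.getD m 0 ≠ c

/-- A main path from `i` to `j` (relative to the pair of symbols `{a, b}`): a path from
`i` to `j` with no intermediate occurrence of `a` nor of `b`. -/
def MainPath (A : ℕ → ℕ → Prop) (a b i j : ℕ) (w : List ℕ) : Prop :=
  IsPath A w ∧ w.headI = i ∧ w.getLastD 0 = j ∧
    ∀ m, 0 < m → m < w.length - 1 → w.getD m 0 ≠ a ∧ w.getD m 0 ≠ b

/-- `p_{ij}^t`: the sum of `exp(ψ(γ) − l(γ)·p)` over all main paths from `i` to `j`. -/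
def pSum (A : ℕ → ℕ → Prop) (ψ : ℕ → ℕ → ℝ) (p : ℝ) (a b i j : ℕ) : ℝ≥0∞ :=
  ∑' w : {w : List ℕ // MainPath A a b i j w},
    ENNReal.ofReal (Real.exp (pathWt ψ w.1 - (pathLen w.1 : ℝ) * p))

/-- `r_{ij}^t`: as `pSum`, restricted to main paths all of whose symbols lie in `S'`. -/
def rSum (A : ℕ → ℕ → Prop) (ψ : ℕ → ℕ → ℝ) (p : ℝ) (a b i j : ℕ) (S' : Finset ℕ) : ℝ≥0∞ :=
  ∑' w : {w : List ℕ // MainPath A a b i j w ∧ ∀ m < w.length, w.getD m 0 ∈ S'},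
    ENNReal.ofReal (Real.exp (pathWt ψ w.1 - (pathLen w.1 : ℝ) * p))

/-- Number of intermediate occurrences of symbols of `I` in the word `w`. -/
def interCount (I : Finset ℕ) (w : List ℕ) : ℕ :=
  ((w.drop 1).take (w.length - 2)).countP (fun s => decide (s ∈ I))

/-- `p_{ij}^t(n)`: as `pSum`, restricted to main paths with exactly `n` intermediate
occurrences of symbols of `I`. -/
def pSumN (A : ℕ → ℕ → Prop) (ψ : ℕ → ℕ → ℝ) (p : ℝ) (a b i j : ℕ)
    (I : Finset ℕ) (n : ℕ) : ℝ≥0∞ :=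
  ∑' w : {w : List ℕ // MainPath A a b i j w ∧ interCount I w = n},
    ENNReal.ofReal (Real.exp (pathWt ψ w.1 - (pathLen w.1 : ℝ) * p))

/-- An `I`-free path from `i` to `j`: a path from `i` to `j` with no intermediate
symbol in `I`. -/
def IFree (A : ℕ → ℕ → Prop) (I : Finset ℕ) (i j : ℕ) (w : List ℕ) : Prop :=
  IsPath A w ∧ w.headI = i ∧ w.getLastD 0 = j ∧
    ∀ m, 0 < m → m < w.length - 1 → w.getD m 0 ∉ I

/-! ## Two-sided countable Markov shifts -/

/-- The two-sided countable Markov shift determined by `A`. -/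
structure MShift2 (A : ℕ → ℕ → Prop) : Type where
  seq : ℤ → ℕ
  adm : ∀ i : ℤ, A (seq i) (seq (i + 1))

instance (A : ℕ → ℕ → Prop) : TopologicalSpace (MShift2 A) :=
  TopologicalSpace.induced MShift2.seq inferInstance

instance (A : ℕ → ℕ → Prop) : MeasurableSpace (MShift2 A) := borel (MShift2 A)

instance (A : ℕ → ℕ → Prop) : BorelSpace (MShift2 A) := ⟨rfl⟩

/-- The (invertible) shift map on the two-sided shift. -/
def shiftMap2 (A : ℕ → ℕ → Prop) (x : MShift2 A) : MShift2 A :=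
  ⟨fun i => x.seq (i + 1), fun i => x.adm (i + 1)⟩

/-- Cylinder based at coordinate 0 in the two-sided shift. -/
def cylSet2 (A : ℕ → ℕ → Prop) (w : List ℕ) : Set (MShift2 A) :=
  {x | ∀ i < w.length, x.seq (i : ℤ) = w.getD i 0}

/-- A path in the two-sided shift: an admissible word `x₀ … xₙ`, `n ≥ 1`. -/
def IsPath2 (A : ℕ → ℕ → Prop) (w : List ℕ) : Prop :=
  2 ≤ w.length ∧ w.Chain' A

/-- σ-invariance of a Borel measure on the two-sided shift. -/
def ShiftInv2 (A : ℕ → ℕ → Prop) (μ : Measure (MShift2 A)) : Prop :=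
  ∀ s : Set (MShift2 A), MeasurableSet s → μ (shiftMap2 A ⁻¹' s) = μ s

/-- Main path from `i` to `j` relative to `{a, b}` in the two-sided shift. -/
def MainPath2 (A : ℕ → ℕ → Prop) (a b i j : ℕ) (w : List ℕ) : Prop :=
  IsPath2 A w ∧ w.headI = i ∧ w.getLastD 0 = j ∧
    ∀ m, 0 < m → m < w.length - 1 → w.getD m 0 ≠ a ∧ w.getD m 0 ≠ b

/-- `p_{ij}`: the sum of `exp(ψ(γ) − l(γ)·P)` over all main paths from `i` to `j`
in the two-sided shift. -/
def pSum2 (A : ℕ → ℕ → Prop) (ψ : ℕ → ℕ → ℝ) (P : ℝ) (a b i j : ℕ) : ℝ≥0∞ :=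
  ∑' w : {w : List ℕ // MainPath2 A a b i j w},
    ENNReal.ofReal (Real.exp (pathWt ψ w.1 - (pathLen w.1 : ℝ) * P))

/-! ## The Ruelle operator and the renewal shift -/

/-- The Ruelle (transfer) operator acting on nonnegative measurable functions. -/
def ruelleOp (A : ℕ → ℕ → Prop) (ψ : MShift A → ℝ) (f : MShift A → ℝ≥0∞)
    (x : MShift A) : ℝ≥0∞ :=
  ∑' y : {y : MShift A // shiftMap A y = x}, ENNReal.ofReal (Real.exp (ψ y.1)) * f y.1

/-- The transition matrix of the renewal shift: `A(1,1) = A(1,i) = A(i, i-1) = 1` for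
every `i > 1`, all other entries `0` (alphabet `{1, 2, …}`). -/
def renewalA : ℕ → ℕ → Prop := fun i j => (i = 1 ∧ 1 ≤ j) ∨ (2 ≤ i ∧ j = i - 1)

/-- The potential `φ(x) = -x₀` on the renewal shift. -/
def phiRen : MShift renewalA → ℝ := fun x => -(x.seq 0 : ℝ)

/-- The potential `φ(x) = x₀ - x₁` on the renewal shift. -/
def phiRen2 : MShift renewalA → ℝ := fun x => (x.seq 0 : ℝ) - (x.seq 1 : ℝ)

/-- The fixed point `1̄ = (1,1,1,…)` of the renewal shift. -/
def onebar : MShift renewalA := ⟨fun _ => 1, fun _ => Or.inl ⟨rfl, le_refl 1⟩⟩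

end

lemma getLastD_eq_getD_length_sub_one (w : List ℕ) :
    w.getLastD 0 = w.getD (w.length - 1) 0 := by
  rw [List.getLastD_eq_getLast?, List.getLast?_eq_getElem?, List.getD_eq_getElem?_getD]

lemma headI_eq_getD_zero (w : List ℕ) : w.headI = w.getD 0 0 := by
  cases w <;> rfl

lemma continuous_seq2 (A : ℕ → ℕ → Prop) (i : ℤ) :
    Continuous (fun x : MShift2 A => x.seq i) :=
  (continuous_apply i).comp (continuous_induced_dom (f := MShift2.seq))

lemma measurable_shiftMap2 (A : ℕ → ℕ → Prop) : Measurable (shiftMap2 A) :=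
  (continuous_induced_rng.2 (continuous_pi fun i => continuous_seq2 A (i + 1))).measurable

lemma measurableSet_seq2_eq (A : ℕ → ℕ → Prop) (i : ℤ) (c : ℕ) :
    MeasurableSet {x : MShift2 A | x.seq i = c} :=
  (continuous_seq2 A i).measurable (measurableSet_singleton c)

lemma measurableSet_cylSet2 (A : ℕ → ℕ → Prop) (w : List ℕ) :
    MeasurableSet (cylSet2 A w) := by
  simp only [cylSet2, Set.ofPred_forall]
  exact MeasurableSet.iInter fun i => MeasurableSet.iInter fun _ => measurableSet_seq2_eq A i _

lemma mem_cylSet2_singleton {A : ℕ → ℕ → Prop} {a : ℕ} {x : MShift2 A} :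
    x ∈ cylSet2 A [a] ↔ x.seq 0 = a := by
  simp [cylSet2]

lemma iterate_shiftMap2_seq (A : ℕ → ℕ → Prop) (k : ℕ) (x : MShift2 A) (i : ℤ) :
    ((shiftMap2 A)^[k] x).seq i = x.seq (i + k) := by
  induction k generalizing x with
  | zero => simp
  | succ k ih =>
    rw [Function.iterate_succ_apply, ih]
    change x.seq (i + k + 1) = _
    congr 1
    push_cast
    ring

lemma ShiftInv2.measurePreserving {A : ℕ → ℕ → Prop} {μ : Measure (MShift2 A)}
    (h : ShiftInv2 A μ) : MeasurePreserving (shiftMap2 A) μ μ := by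
  refine ⟨measurable_shiftMap2 A, Measure.ext fun s hs => ?_⟩
  rw [Measure.map_apply (measurable_shiftMap2 A) hs, h s hs]

/-- The points of `[a]` whose forward orbit hits `b` before returning to `a`. -/
def hitsBeforeReturn (A : ℕ → ℕ → Prop) (a b : ℕ) : Set (MShift2 A) :=
  {x | x.seq 0 = a ∧
    ∃ j : ℕ, 0 < j ∧ x.seq j = b ∧ ∀ i : ℕ, 0 < i → i < j → x.seq i ≠ a}

lemma measurableSet_hitsBeforeReturn (A : ℕ → ℕ → Prop) (a b : ℕ) :
    MeasurableSet (hitsBeforeReturn A a b) := by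
  refine (measurableSet_seq2_eq A 0 a).inter ?_
  change MeasurableSet {x : MShift2 A | ∃ j : ℕ, 0 < j ∧ x.seq j = b ∧
    ∀ i : ℕ, 0 < i → i < j → x.seq i ≠ a}
  simp only [Set.ofPred_exists, Set.ofPred_and, Set.ofPred_forall]
  refine MeasurableSet.iUnion fun j => (MeasurableSet.const _).inter
    ((measurableSet_seq2_eq A j b).inter ?_)
  exact MeasurableSet.iInter fun i => MeasurableSet.iInter fun _ => MeasurableSet.iInter fun _ =>
    (measurableSet_seq2_eq A i a).compl

lemma exists_cylSet2_subset_preimage_hitsBeforeReturn (A : ℕ → ℕ → Prop) {a b : ℕ}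
    {w : List ℕ} (hhead : w.headI = a) (hthrough : PassesThrough w b) :
    ∃ k : ℕ, cylSet2 A w ⊆ (shiftMap2 A)^[k] ⁻¹' hitsBeforeReturn A a b := by
  obtain ⟨m, hm0, hml, hmb⟩ := hthrough
  have h0 : w.getD 0 0 = a := by rw [← headI_eq_getD_zero, hhead]
  let Q : ℕ → Prop := fun k => w.getD k 0 = a
  set k := Nat.findGreatest Q (m - 1)
  have hkm : k ≤ m - 1 := Nat.findGreatest_le _
  have hQk : w.getD k 0 = a := Nat.findGreatest_spec (P := Q) (Nat.zero_le _) h0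
  refine ⟨k, fun x hx => ⟨?_, m - k, by omega, ?_, fun i hi him => ?_⟩⟩
  · rw [iterate_shiftMap2_seq, zero_add, hx k (by omega), hQk]
  · rw [iterate_shiftMap2_seq, ← Nat.cast_add, hx _ (by omega), Nat.sub_add_cancel (by omega), hmb]
  · rw [iterate_shiftMap2_seq, ← Nat.cast_add, hx _ (by omega)]
    exact Nat.findGreatest_is_greatest (P := Q) (n := m - 1) (by omega) (by omega)

lemma MainPath2.seq_eq {A : ℕ → ℕ → Prop} {a b i j : ℕ} {w : List ℕ}
    (hw : MainPath2 A a b i j w) {x : MShift2 A} (hx : x ∈ cylSet2 A w) :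
    x.seq 0 = i ∧ x.seq (w.length - 1 : ℕ) = j ∧
      ∀ m : ℕ, 0 < m → m < w.length - 1 → x.seq m ≠ a ∧ x.seq m ≠ b := by
  obtain ⟨⟨hlen, -⟩, hhead, hlast, hmid⟩ := hw
  refine ⟨?_, ?_, fun m hm hml => ?_⟩
  · rw [← hhead, headI_eq_getD_zero, ← hx 0 (by omega), Nat.cast_zero]
  · rw [hx _ (by omega), ← hlast, getLastD_eq_getD_length_sub_one]
  · rw [hx m (by omega)]
    exact hmid m hm hml

lemma disjoint_cylSet2_hitsBeforeReturn {A : ℕ → ℕ → Prop} {a b i : ℕ} (hab : a ≠ b)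
    {w : List ℕ} (hw : MainPath2 A a b i a w) :
    Disjoint (cylSet2 A w) (hitsBeforeReturn A a b) := by
  rw [Set.disjoint_left]
  rintro x hx ⟨-, j, hj, hjb, hja⟩
  obtain ⟨-, hlast, hmid⟩ := hw.seq_eq hx
  have hlen := hw.1.1
  rcases lt_trichotomy j (w.length - 1) with h | h | h
  · exact (hmid j hj h).2 hjb
  · exact hab (by rw [← hlast, ← h, hjb])
  · exact hja _ (by omega) h hlast

lemma MainPath2.eq_of_mem_cylSet2 {A : ℕ → ℕ → Prop} {a b i : ℕ} {v w : List ℕ}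
    (hv : MainPath2 A a b i a v) (hw : MainPath2 A a b i a w) {x : MShift2 A}
    (hxv : x ∈ cylSet2 A v) (hxw : x ∈ cylSet2 A w) : v = w := by
  obtain ⟨-, hvlast, hvmid⟩ := hv.seq_eq hxv
  obtain ⟨-, hwlast, hwmid⟩ := hw.seq_eq hxw
  have hvlen := hv.1.1
  have hwlen := hw.1.1
  have hlen : v.length = w.length := by
    rcases lt_trichotomy (v.length - 1) (w.length - 1) with h | h | h
    · exact absurd hvlast (hwmid _ (by omega) h).1
    · omega
    · exact absurd hwlast (hvmid _ (by omega) h).1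
  refine List.ext_getElem hlen fun m h₁ h₂ => ?_
  rw [← List.getD_eq_getElem v 0 h₁, ← List.getD_eq_getElem w 0 h₂, ← hxv m h₁, ← hxw m h₂]

/-- The first-return loops at `a` avoiding `b` and the event of hitting `b` before returning
to `a` are disjoint parts of the cylinder `[a]`. -/
lemma tsum_mainPath2_add_hitsBeforeReturn_le (A : ℕ → ℕ → Prop) {a b : ℕ} (hab : a ≠ b)
    (μ : Measure (MShift2 A)) :
    (∑' w : {w : List ℕ // MainPath2 A a b a a w}, μ (cylSet2 A w.1)) +
      μ (hitsBeforeReturn A a b) ≤ μ (cylSet2 A [a]) := by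
  rw [← measure_iUnion
    (fun v w hvw => Set.disjoint_left.2 fun x hxv hxw =>
      hvw (Subtype.ext (v.2.eq_of_mem_cylSet2 w.2 hxv hxw)))
    (fun w => measurableSet_cylSet2 A w.1),
    ← measure_union (Set.disjoint_iUnion_left.2 fun w => disjoint_cylSet2_hitsBeforeReturn hab w.2)
      (measurableSet_hitsBeforeReturn A a b)]
  refine measure_mono (Set.union_subset (Set.iUnion_subset fun w x hx => ?_) fun x hx => ?_)
  · exact mem_cylSet2_singleton.2 (w.2.seq_eq hx).1
  · exact mem_cylSet2_singleton.2 hx.1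

/-- Lower bound `1 − p_{aa} ≥ exp(−B − N·P)` from the existence of a
short loop at `a` through `b` of controlled weight. -/
theorem stmt9 (A : ℕ → ℕ → Prop) (hA : NoZeroRC A) (ψ : ℕ → ℕ → ℝ)
    (P : ℝ) (hP0 : 0 ≤ P)
    (a b : ℕ) (hab : a ≠ b) (μ : Measure (MShift2 A)) (hprob : IsProbabilityMeasure μ)
    (hinv : ShiftInv2 A μ)
    (hapos : 0 < μ (cylSet2 A [a])) (hbpos : 0 < μ (cylSet2 A [b]))
    (harec : μ {x : MShift2 A | ∀ N : ℕ, ∃ i : ℕ, N ≤ i ∧ x.seq (i : ℤ) = a} = 1)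
    (hbrec : μ {x : MShift2 A | ∀ N : ℕ, ∃ i : ℕ, N ≤ i ∧ x.seq (i : ℤ) = b} = 1)
    (hloop : ∀ w : List ℕ, IsPath2 A w → w.getLastD 0 = w.headI →
      μ (cylSet2 A w) = μ (cylSet2 A [w.headI]) *
        ENNReal.ofReal (Real.exp (pathWt ψ w - (pathLen w : ℝ) * P)))
    (N : ℕ) (B : ℝ) (hB : 0 ≤ B) (δ : List ℕ)
    (hδpath : IsPath2 A δ) (hδhead : δ.headI = a) (hδlast : δ.getLastD 0 = a)
    (hδthrough : PassesThrough δ b) (hδlen : pathLen δ ≤ N) (hδwt : -B ≤ pathWt ψ δ) :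
    ENNReal.ofReal (Real.exp (-B - (N : ℝ) * P)) ≤ 1 - pSum2 A ψ P a b a a := by
  obtain ⟨k, hk⟩ := exists_cylSet2_subset_preimage_hitsBeforeReturn A hδhead hδthrough
  have hδE : μ (cylSet2 A δ) ≤ μ (hitsBeforeReturn A a b) :=
    (measure_mono hk).trans_eq ((hinv.measurePreserving.iterate k).measure_preimage
      (measurableSet_hitsBeforeReturn A a b).nullMeasurableSet)
  have hδμ : μ (cylSet2 A [a]) * ENNReal.ofReal (Real.exp (-B - (N : ℝ) * P)) ≤
      μ (cylSet2 A δ) := by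
    rw [hloop δ hδpath (hδlast.trans hδhead.symm), hδhead]
    have : (pathLen δ : ℝ) * P ≤ N * P :=
      mul_le_mul_of_nonneg_right (by exact_mod_cast hδlen) hP0
    gcongr
  have hsum : ∑' w : {w : List ℕ // MainPath2 A a b a a w}, μ (cylSet2 A w.1) =
      μ (cylSet2 A [a]) * pSum2 A ψ P a b a a := by
    rw [pSum2, ← ENNReal.tsum_mul_left]
    refine tsum_congr fun w => ?_
    obtain ⟨hpath, hhead, hlast, -⟩ := w.2
    rw [hloop w.1 hpath (hlast.trans hhead.symm), hhead]
  have hle : μ (cylSet2 A [a]) *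
      (ENNReal.ofReal (Real.exp (-B - (N : ℝ) * P)) + pSum2 A ψ P a b a a) ≤
      μ (cylSet2 A [a]) * 1 := by
    rw [mul_add, mul_one, ← hsum, add_comm]
    exact (add_le_add_right (hδμ.trans hδE) _).trans
      (tsum_mainPath2_add_hitsBeforeReturn_le A hab μ)
  have hone := (ENNReal.mul_le_mul_iff_right hapos.ne' (measure_ne_top μ _)).1 hle
  exact ENNReal.le_sub_of_add_le_right
    (ne_top_of_le_ne_top ENNReal.one_ne_top (le_add_self.trans hone)) hone
end

section
/- Let Σ be a topologically transitive countable Markov shift and φ : Σ → ℝ a summable Markov potential with φ ≤ 0, α(φ) = 0, Var_1(φ) < ∞ and P_G(φ) < ∞. Let I ⊂ ℕ be finite and d > 0 be such that sup φ|_{[i]} < −d for every i ∉ I. Let C ≥ 0, set c = C + 2d/7, and let S' ⊂ ℕ be a finite set of symbols containing I and containing every i ∈ ℕ with sup φ|_{[i]} ≥ −7c. Assume the map t ↦ P_G(tφ) is nonincreasing on [1, ∞) with P_G(tφ) ≥ 0 for all t ≥ 1, and that for every s ≥ 1 and all i, j ∈ I the sum of exp(sφ(γ) − l(γ)·P_G(sφ))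 over all I-free paths γ from i to j is finite. Then there exist T > 0 and K < ∞ such that for every t ≥ T + 1 and all i, j ∈ I, the sum of exp(tφ(γ) − l(γ)·P_G(tφ)) over all I-free paths γ from i to j that contain at least one intermediate symbol outside S' is at most K·exp(−7Ct). -/
open MeasureTheory Filter Topology BoundedContinuousFunction
open scoped ENNReal NNReal

theorem pathWt_eq_sum (ψ : ℕ → ℕ → ℝ) (w : List ℕ) :
    pathWt ψ w = ∑ k ∈ Finset.range (pathLen w), ψ (w.getD k 0) (w.getD (k + 1) 0) := by
  induction w with
  | nil => simp [pathWt, pathLen]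
  | cons a l ih =>
    cases l with
    | nil => simp [pathWt, pathLen]
    | cons b l =>
      have hlen : pathLen (a :: b :: l) = pathLen (b :: l) + 1 := by simp [pathLen]
      rw [hlen, Finset.sum_range_succ', pathWt, ih, add_comm]
      simp

theorem pathWt_const_mul (t : ℝ) (ψ : ℕ → ℕ → ℝ) (w : List ℕ) :
    pathWt (fun u v => t * ψ u v) w = t * pathWt ψ w := by
  simp only [pathWt_eq_sum, Finset.mul_sum]

/-- Every edge of a path is the initial edge of some point of the shift. -/
theorem IsPath.exists_edge {A : ℕ → ℕ → Prop} {w : List ℕ} (hw : IsPath A w) {k : ℕ}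
    (hk : k < pathLen w) :
    ∃ x : MShift A, x.seq 0 = w.getD k 0 ∧ x.seq 1 = w.getD (k + 1) 0 := by
  obtain ⟨-, -, x, hx⟩ := hw
  unfold pathLen at hk
  refine ⟨⟨fun i => x.seq (k + i), fun i => x.adm (k + i)⟩, ?_, ?_⟩
  · exact hx k (by omega)
  · exact hx (k + 1) (by omega)

/-- An `I`-free path visiting a symbol where the potential is at most `-(B + 2d)` has weight at
most `-(B + d · length)`, if the potential is at most `-d` off `I`. -/
theorem IFree.pathWt_le {A : ℕ → ℕ → Prop} {ψ : ℕ → ℕ → ℝ} {φ : MShift A → ℝ}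
    (hMarkov : ∀ x, φ x = ψ (x.seq 0) (x.seq 1)) (hneg : ∀ x, φ x ≤ 0)
    {I : Finset ℕ} {d B : ℝ} (hI : ∀ i ∉ I, ∀ x : MShift A, x.seq 0 = i → φ x ≤ -d)
    {i j : ℕ} {w : List ℕ} (hw : IFree A I i j w) {m : ℕ} (hm0 : 0 < m)
    (hm : m < w.length - 1)
    (hB : ∀ x : MShift A, x.seq 0 = w.getD m 0 → φ x ≤ -(B + 2 * d)) :
    pathWt ψ w ≤ -(B + pathLen w * d) := by
  obtain ⟨hpath, -, -, hfree⟩ := hw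
  have hedge : ∀ k ∈ Finset.range (pathLen w), ψ (w.getD k 0) (w.getD (k + 1) 0) ≤
      -d + (if k = 0 then d else 0) + (if k = m then -(B + d) else 0) := by
    intro k hk
    rw [Finset.mem_range] at hk
    obtain ⟨x, hx0, hx1⟩ := hpath.exists_edge hk
    rw [← hx0, ← hx1, ← hMarkov]
    split_ifs with h0 h1 h1
    · omega
    · linarith [hneg x]
    · subst h1
      linarith [hB x hx0]
    · linarith [hI _ (hfree k (Nat.pos_of_ne_zero h0) hk) x hx0]
  have hmem0 : 0 ∈ Finset.range (pathLen w) := Finset.mem_range.2 (hm0.trans hm)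
  have hmem : m ∈ Finset.range (pathLen w) := Finset.mem_range.2 hm
  rw [pathWt_eq_sum]
  refine (Finset.sum_le_sum hedge).trans_eq ?_
  rw [Finset.sum_add_distrib, Finset.sum_add_distrib, Finset.sum_ite_eq', Finset.sum_ite_eq',
    if_pos hmem0, if_pos hmem, Finset.sum_const, Finset.card_range, nsmul_eq_mul]
  ring

/-- (Escape estimate.) There are `T > 0` and `K < ∞` such that for all
`t ≥ T + 1` the contribution of `I`-free paths leaving the finite subalphabet `S'` is at
most `K·exp(−7Ct)`. -/
theorem stmt11 (A : ℕ → ℕ → Prop) (hA : NoZeroRC A) (hTrans : TopTrans A)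
    (ψ : ℕ → ℕ → ℝ) (φ : MShift A → ℝ) (hMarkov : ∀ x, φ x = ψ (x.seq 0) (x.seq 1))
    (hneg : ∀ x, φ x ≤ 0) (hnorm : alphaSup A φ = 0)
    (hsum : SummablePot A φ) (V : ℝ) (hV : VarBdd A φ 1 V)
    (hfin : ∀ a : ℕ, PGur A φ a < ⊤)
    (I : Finset ℕ) (d : ℝ) (hd : 0 < d)
    (hI : ∀ i ∉ I, ∀ x : MShift A, x.seq 0 = i → φ x ≤ -d)
    (C : ℝ) (hC : 0 ≤ C)
    (S' : Finset ℕ) (hIS : I ⊆ S')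
    (hS' : ∀ i : ℕ, (∃ x : MShift A, x.seq 0 = i ∧ -(7 * (C + 2 * d / 7)) ≤ φ x) → i ∈ S')
    (P : ℝ → ℝ) (hP : ∀ t : ℝ, 1 ≤ t → IsPG A (fun x => t * φ x) ((P t : ℝ) : EReal))
    (hPmono : ∀ t₁ t₂ : ℝ, 1 ≤ t₁ → t₁ ≤ t₂ → P t₂ ≤ P t₁)
    (hP0 : ∀ t : ℝ, 1 ≤ t → 0 ≤ P t)
    (hfree : ∀ s : ℝ, 1 ≤ s → ∀ i ∈ I, ∀ j ∈ I,
      (∑' w : {w : List ℕ // IFree A I i j w},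
        ENNReal.ofReal (Real.exp (pathWt (fun u v => s * ψ u v) w.1
          - (pathLen w.1 : ℝ) * P s))) ≠ ⊤) :
    ∃ T : ℝ, 0 < T ∧ ∃ K : ℝ, ∀ t : ℝ, T + 1 ≤ t → ∀ i ∈ I, ∀ j ∈ I,
      (∑' w : {w : List ℕ // IFree A I i j w ∧
          ∃ m, 0 < m ∧ m < w.length - 1 ∧ w.getD m 0 ∉ S'},
        ENNReal.ofReal (Real.exp (pathWt (fun u v => t * ψ u v) w.1
          - (pathLen w.1 : ℝ) * P t)))
        ≤ ENNReal.ofReal (K * Real.exp (-(7 * C * t))) := by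
  set F : ℕ → ℕ → ℝ≥0∞ := fun i j => ∑' w : {w : List ℕ // IFree A I i j w},
    ENNReal.ofReal (Real.exp (pathWt ψ w.1 - (pathLen w.1 : ℝ) * P 1))
  have hFtop : ∀ i ∈ I, ∀ j ∈ I, F i j ≠ ⊤ := by
    intro i hi j hj
    simpa only [one_mul] using hfree 1 le_rfl i hi j hj
  have hsum_ne_top : ∑ i ∈ I, ∑ j ∈ I, F i j ≠ ⊤ :=
    ENNReal.sum_ne_top.2 fun i hi => ENNReal.sum_ne_top.2 fun j hj => hFtop i hi j hj
  set S : ℝ := (∑ i ∈ I, ∑ j ∈ I, F i j).toReal with hS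
  have hFS : ∀ i ∈ I, ∀ j ∈ I, F i j ≤ ENNReal.ofReal S := by
    intro i hi j hj
    rw [hS, ENNReal.ofReal_toReal hsum_ne_top]
    exact (Finset.single_le_sum (f := fun j => F i j) (fun _ _ => zero_le) hj).trans
      (Finset.single_le_sum (f := fun i => ∑ j ∈ I, F i j) (fun _ _ => zero_le) hi)
  have hT : 0 ≤ P 1 / d := div_nonneg (hP0 1 le_rfl) hd.le
  refine ⟨P 1 / d + 1, by linarith, Real.exp (7 * C) * S, fun t ht i hi j hj => ?_⟩
  have ht1 : 0 ≤ t - 1 := by linarith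
  have htd : P 1 ≤ (t - 1) * d := by
    rw [← div_le_iff₀ hd]
    linarith
  have hterm : ∀ w : List ℕ, IFree A I i j w →
      (∃ m, 0 < m ∧ m < w.length - 1 ∧ w.getD m 0 ∉ S') →
      Real.exp (pathWt (fun u v => t * ψ u v) w - (pathLen w : ℝ) * P t) ≤
        Real.exp (7 * C - 7 * C * t) * Real.exp (pathWt ψ w - (pathLen w : ℝ) * P 1) := by
    rintro w hw ⟨m, hm0, hm, hmS⟩
    have hwt : pathWt ψ w ≤ -(7 * C + pathLen w * d) := by
      refine hw.pathWt_le hMarkov hneg hI hm0 hm fun x hx => ?_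
      by_contra! h
      exact hmS (hS' _ ⟨x, hx, by linarith⟩)
    have hn : (0 : ℝ) ≤ pathLen w := Nat.cast_nonneg _
    have h1 := mul_le_mul_of_nonneg_left hwt ht1
    have h2 := mul_le_mul_of_nonneg_left htd hn
    have h3 := mul_nonneg hn (hP0 t (by linarith))
    rw [← Real.exp_add, pathWt_const_mul, Real.exp_le_exp]
    linarith
  calc _ ≤ ∑' w : {w : List ℕ // IFree A I i j w ∧
            ∃ m, 0 < m ∧ m < w.length - 1 ∧ w.getD m 0 ∉ S'},
          ENNReal.ofReal (Real.exp (7 * C - 7 * C * t)) *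
            ENNReal.ofReal (Real.exp (pathWt ψ w.1 - (pathLen w.1 : ℝ) * P 1)) := by
        refine ENNReal.tsum_le_tsum fun w => ?_
        rw [← ENNReal.ofReal_mul (Real.exp_nonneg _)]
        exact ENNReal.ofReal_le_ofReal (hterm w.1 w.2.1 w.2.2)
    _ ≤ ENNReal.ofReal (Real.exp (7 * C - 7 * C * t)) * F i j := by
        rw [ENNReal.tsum_mul_left]
        gcongr
        exact ENNReal.tsum_comp_le_tsum_of_injective
          (f := Subtype.map id fun _ h => h.1) (Subtype.map_injective _ Function.injective_id)
          fun w : {w : List ℕ // IFree A I i j w} =>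
            ENNReal.ofReal (Real.exp (pathWt ψ w.1 - (pathLen w.1 : ℝ) * P 1))
    _ ≤ ENNReal.ofReal (Real.exp (7 * C - 7 * C * t)) * ENNReal.ofReal S := by
        gcongr
        exact hFS i hi j hj
    _ = ENNReal.ofReal (Real.exp (7 * C) * S * Real.exp (-(7 * C * t))) := by
        rw [← ENNReal.ofReal_mul (Real.exp_nonneg _), sub_eq_add_neg, Real.exp_add]
        ring_nf
end
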